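/- Let A ∈ ℂ^{m×n}, S ∈ ℂ^{q×n}, and W ∈ ℂ^{q×p}, and let θ ≥ 0 satisfy ‖A†A − S†S‖_F ≤ θ and ‖SS† − WW†‖_F ≤ θ. Let σ_i(·) denote the i-th largest singular value of a matrix (defined as 0 beyond the matrix's rank). Then for every k ≥ 1, Σ_{i=1}^k |σ_i(A)² − σ_i(W)²| ≤ 2√k·θ. -/

import Mathlib

open Finset Matrix

/-- `a` is the nonincreasing list of eigenvalues of the `n × n` matrix `M`, extended by zero. -/
def IsSpectralSeq {n : ℕ} (M : Matrix (Fin n) (Fin n) ℂ) (a : ℕ → ℝ) : Prop :=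
  Antitone a ∧ (∀ i, n ≤ i → a i = 0) ∧ ∃ U ∈ Matrix.unitaryGroup (Fin n) ℂ,
    M = U * Matrix.diagonal (fun i : Fin n => ((a i.val : ℝ) : ℂ)) * Uᴴ

open scoped ComplexOrder in
lemma Matrix.PosSemidef.exists_isSpectralSeq {n : ℕ} {M : Matrix (Fin n) (Fin n) ℂ}
    (hM : M.PosSemidef) : ∃ a, IsSpectralSeq M a := by
  set d := hM.isHermitian.eigenvalues with hd
  set σ := Tuple.sort (fun i => -d i)
  have hmono : Monotone ((fun i => -d i) ∘ σ) := Tuple.monotone_sort _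
  refine ⟨fun i => if h : i < n then d (σ ⟨i, h⟩) else 0, ?_, ?_, ?_⟩
  · intro i j hij
    dsimp only
    by_cases hj : j < n
    · have hi : i < n := hij.trans_lt hj
      have := @hmono ⟨i, hi⟩ ⟨j, hj⟩ hij
      simpa [hi, hj] using this
    · by_cases hi : i < n
      · simpa [hi, hj] using hM.eigenvalues_nonneg _
      · simp [hi, hj]
  · intro i hi
    simp [hi.not_gt]
  · set U : Matrix (Fin n) (Fin n) ℂ := hM.isHermitian.eigenvectorUnitary.1
    have hU : U * Uᴴ = 1 := mem_unitaryGroup_iff.1 (hM.isHermitian.eigenvectorUnitary).2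
    refine ⟨U.submatrix id σ, ?_, ?_⟩
    · rw [mem_unitaryGroup_iff, star_eq_conjTranspose, conjTranspose_submatrix,
        submatrix_mul_equiv, hU]
      simp
    · have h := hM.isHermitian.spectral_theorem
      rw [Unitary.conjStarAlgAut_apply] at h
      have hdiag : (diagonal fun i : Fin n =>
          (((if h : i.val < n then d (σ ⟨i.val, h⟩) else 0 : ℝ)) : ℂ)) =
          (diagonal (fun i => (d i : ℂ))).submatrix σ σ := by
        ext i j
        simp [diagonal_apply]
      rw [hdiag, conjTranspose_submatrix, submatrix_mul_equiv, submatrix_mul_equiv, submatrix_id_id]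
      exact h

open scoped ComplexOrder in
lemma exists_isSpectralSeq_conjTranspose_mul_self {n q : ℕ} (M : Matrix (Fin q) (Fin n) ℂ) :
    ∃ a, IsSpectralSeq (Mᴴ * M) a :=
  (posSemidef_conjTranspose_mul_self M).exists_isSpectralSeq

lemma IsSpectralSeq.charpoly_eq {n : ℕ} {M : Matrix (Fin n) (Fin n) ℂ} {a : ℕ → ℝ}
    (h : IsSpectralSeq M a) :
    M.charpoly = ∏ i ∈ range n, (Polynomial.X - Polynomial.C (a i : ℂ)) := by
  obtain ⟨-, -, U, hU, rfl⟩ := h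
  rw [mul_assoc, charpoly_mul_comm, mul_assoc, ← star_eq_conjTranspose,
    mem_unitaryGroup_iff'.1 hU, mul_one, charpoly_diagonal,
    Finset.prod_range fun i => (Polynomial.X - Polynomial.C (a i : ℂ))]

lemma IsSpectralSeq.charpoly_mul_X_pow {n : ℕ} {M : Matrix (Fin n) (Fin n) ℂ} {a : ℕ → ℝ}
    (h : IsSpectralSeq M a) (m : ℕ) :
    Polynomial.X ^ m * M.charpoly =
      ∏ i ∈ range (n + m), (Polynomial.X - Polynomial.C (a i : ℂ)) := by
  rw [Finset.prod_range_add, h.charpoly_eq, mul_comm]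
  simp [h.2.1]

lemma Antitone.eq_of_multiset_map_range_eq {a b : ℕ → ℝ} (ha : Antitone a) (hb : Antitone b)
    {N : ℕ} (h : (Multiset.range N).map a = (Multiset.range N).map b) {i : ℕ} (hi : i < N) :
    a i = b i := by
  have hperm : ((List.range N).map a).Perm ((List.range N).map b) := Multiset.coe_eq_coe.1 h
  have hs (c : ℕ → ℝ) (hc : Antitone c) : ((List.range N).map c).Pairwise (· ≥ ·) :=
    List.pairwise_map.2 (List.pairwise_lt_range.imp fun h => hc h.le)
  have := hperm.eq_of_pairwise' (hs a ha) (hs b hb)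
  exact List.map_inj_left.1 this i (List.mem_range.2 hi)

lemma IsSpectralSeq.mul_conjTranspose_self {n q : ℕ} {M : Matrix (Fin q) (Fin n) ℂ} {a : ℕ → ℝ}
    (h : IsSpectralSeq (Mᴴ * M) a) : IsSpectralSeq (M * Mᴴ) a := by
  obtain ⟨b, hb⟩ := exists_isSpectralSeq_conjTranspose_mul_self Mᴴ
  rw [conjTranspose_conjTranspose] at hb
  suffices a = b from this ▸ hb
  have hpoly := charpoly_mul_comm' M Mᴴ
  simp only [Fintype.card_fin] at hpoly
  rw [h.charpoly_mul_X_pow, hb.charpoly_mul_X_pow, add_comm q n] at hpoly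
  have hroots := congrArg Polynomial.roots hpoly
  have key (c : ℕ → ℝ) : (∏ i ∈ range (n + q), (Polynomial.X - Polynomial.C (c i : ℂ))).roots =
      ((Multiset.range (n + q)).map c).map ((↑) : ℝ → ℂ) := by
    rw [← Polynomial.roots_multiset_prod_X_sub_C (Multiset.map _ _), Multiset.map_map,
      Multiset.map_map]
    rfl
  rw [key, key] at hroots
  have hmap := Multiset.map_injective Complex.ofReal_injective hroots
  ext i
  by_cases hi : i < n + q
  · exact h.1.eq_of_multiset_map_range_eq hb.1 hmap.symm hi
  · rw [h.2.1 i (by omega), hb.2.1 i (by omega)]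

lemma sum_sub_sq_le_sum_of_doublyStochastic {n : ℕ} {P : Matrix (Fin n) (Fin n) ℝ}
    (hP : P ∈ doublyStochastic ℝ (Fin n)) {a b : Fin n → ℝ} (ha : Antitone a) (hb : Antitone b) :
    ∑ i, (a i - b i) ^ 2 ≤ ∑ i, ∑ j, P i j * (a i - b j) ^ 2 := by
  obtain ⟨w, hw0, hw1, rfl⟩ := exists_eq_sum_perm_of_mem_doublyStochastic hP
  have hperm (σ : Equiv.Perm (Fin n)) : ∑ i, (a i - b i) ^ 2 ≤ ∑ i, (a i - b (σ i)) ^ 2 := by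
    have h1 : ∑ i, a i * b (σ i) ≤ ∑ i, a i * b i :=
      (ha.monovary hb).sum_mul_comp_perm_le_sum_mul
    have h2 : ∑ i, b (σ i) ^ 2 = ∑ i, b i ^ 2 := Equiv.sum_comp σ fun i => b i ^ 2
    simp only [sub_sq, sum_add_distrib, sum_sub_distrib, mul_assoc, ← mul_sum, h2]
    linarith
  calc ∑ i, (a i - b i) ^ 2 = ∑ σ, w σ * ∑ i, (a i - b i) ^ 2 := by
        rw [← sum_mul, hw1, one_mul]
    _ ≤ ∑ σ, w σ * ∑ i, (a i - b (σ i)) ^ 2 :=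
        sum_le_sum fun σ _ => mul_le_mul_of_nonneg_left (hperm σ) (hw0 σ)
    _ = _ := by
        simp only [Matrix.sum_apply, sum_mul, mul_sum]
        rw [sum_comm]
        refine sum_congr rfl fun i _ => ?_
        rw [sum_comm]
        refine sum_congr rfl fun σ _ => ?_
        simp [Equiv.Perm.permMatrix, PEquiv.toMatrix_apply]

lemma Matrix.sum_norm_sq_eq_trace {n : ℕ} (M : Matrix (Fin n) (Fin n) ℂ) :
    ((∑ i, ∑ j, ‖M i j‖ ^ 2 : ℝ) : ℂ) = (Mᴴ * M).trace := by
  simp only [trace, diag_apply, mul_apply, conjTranspose_apply, Complex.ofReal_sum]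
  rw [sum_comm]
  refine sum_congr rfl fun i _ => sum_congr rfl fun j _ => ?_
  simp [← Complex.conj_mul']

lemma Matrix.sum_norm_sq_unitary_conj {n : ℕ} {U V : Matrix (Fin n) (Fin n) ℂ}
    (hU : U ∈ unitaryGroup (Fin n) ℂ) (hV : V ∈ unitaryGroup (Fin n) ℂ)
    (M : Matrix (Fin n) (Fin n) ℂ) :
    ∑ i, ∑ j, ‖(Uᴴ * M * V) i j‖ ^ 2 = ∑ i, ∑ j, ‖M i j‖ ^ 2 := by
  apply Complex.ofReal_injective
  have hU' : U * Uᴴ = 1 := mem_unitaryGroup_iff.1 hU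
  have hV' : V * Vᴴ = 1 := mem_unitaryGroup_iff.1 hV
  rw [sum_norm_sq_eq_trace, sum_norm_sq_eq_trace]
  calc _ = (Vᴴ * (Mᴴ * (U * Uᴴ) * M * V)).trace := by
        simp only [conjTranspose_mul, conjTranspose_conjTranspose, Matrix.mul_assoc]
    _ = _ := by rw [trace_mul_comm, Matrix.mul_assoc, hV', hU', mul_one, mul_one]

lemma Matrix.sq_norm_mem_doublyStochastic {n : ℕ} {Q : Matrix (Fin n) (Fin n) ℂ}
    (hQ : Q ∈ unitaryGroup (Fin n) ℂ) :
    (Matrix.of fun i j => ‖Q i j‖ ^ 2) ∈ doublyStochastic ℝ (Fin n) := by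
  rw [mem_doublyStochastic_iff_sum]
  refine ⟨fun i j => by simp, fun i => ?_, fun j => ?_⟩
  · have h := congrFun (congrFun (mem_unitaryGroup_iff.1 hQ) i) i
    simp only [mul_apply, star_apply, one_apply_eq, RCLike.star_def, Complex.mul_conj'] at h
    exact_mod_cast h
  · have h := congrFun (congrFun (mem_unitaryGroup_iff'.1 hQ) j) j
    simp only [mul_apply, star_apply, one_apply_eq, RCLike.star_def, Complex.conj_mul'] at h
    exact_mod_cast h

/-- The Hoffman–Wielandt inequality. -/
lemma IsSpectralSeq.sum_sub_sq_le {n : ℕ} {M N : Matrix (Fin n) (Fin n) ℂ} {a b : ℕ → ℝ}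
    (hM : IsSpectralSeq M a) (hN : IsSpectralSeq N b) :
    ∑ i ∈ range n, (a i - b i) ^ 2 ≤ ∑ i, ∑ j, ‖(M - N) i j‖ ^ 2 := by
  obtain ⟨ha, -, U, hU, rfl⟩ := hM
  obtain ⟨hb, -, V, hV, rfl⟩ := hN
  have hQ : Uᴴ * V ∈ unitaryGroup (Fin n) ℂ := mul_mem (Unitary.star_mem hU) hV
  have hU' : Uᴴ * U = 1 := mem_unitaryGroup_iff'.1 hU
  have hV' : Vᴴ * V = 1 := mem_unitaryGroup_iff'.1 hV
  rw [← sum_norm_sq_unitary_conj hU hV, Finset.sum_range fun i => (a i - b i) ^ 2]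
  refine (sum_sub_sq_le_sum_of_doublyStochastic (sq_norm_mem_doublyStochastic hQ)
    (ha.comp_monotone Fin.val_strictMono.monotone)
    (hb.comp_monotone Fin.val_strictMono.monotone)).trans_eq ?_
  have hconj (D E : Matrix (Fin n) (Fin n) ℂ) :
      Uᴴ * (U * D * Uᴴ - V * E * Vᴴ) * V = D * (Uᴴ * V) - Uᴴ * V * E := by
    calc _ = (Uᴴ * U) * D * (Uᴴ * V) - Uᴴ * V * E * (Vᴴ * V) := by noncomm_ring
      _ = _ := by rw [hU', hV', one_mul, mul_one]
  refine sum_congr rfl fun i _ => sum_congr rfl fun j _ => ?_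
  rw [hconj, Matrix.sub_apply, diagonal_mul, mul_diagonal, mul_comm ((Uᴴ * V) i j), ← sub_mul,
    ← Complex.ofReal_sub, norm_mul, mul_pow, Complex.norm_real, Real.norm_eq_abs, sq_abs]
  simp [mul_comm]

lemma IsSpectralSeq.sum_abs_sub_le {n : ℕ} {M N : Matrix (Fin n) (Fin n) ℂ} {a b : ℕ → ℝ}
    (hM : IsSpectralSeq M a) (hN : IsSpectralSeq N b) (k : ℕ) :
    ∑ i ∈ range k, |a i - b i| ≤ √k * √(∑ i, ∑ j, ‖(M - N) i j‖ ^ 2) := by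
  have hk : ∑ i ∈ range k, (a i - b i) ^ 2 ≤ ∑ i ∈ range n, (a i - b i) ^ 2 := by
    have hzero : ∀ i ∈ range k \ range n, (a i - b i) ^ 2 = 0 := fun i hi => by
      have hi : n ≤ i := by simpa using (mem_sdiff.1 hi).2
      simp [hM.2.1 i hi, hN.2.1 i hi]
    rw [← sum_inter_add_sum_sdiff (range k) (range n), sum_eq_zero hzero, add_zero]
    exact sum_le_sum_of_subset_of_nonneg inter_subset_right fun i _ _ => sq_nonneg _
  rw [← Real.sqrt_mul (Nat.cast_nonneg k)]
  refine Real.le_sqrt_of_sq_le ?_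
  calc (∑ i ∈ range k, |a i - b i|) ^ 2 ≤ k * ∑ i ∈ range k, |a i - b i| ^ 2 := by
        simpa using sq_sum_le_card_mul_sum_sq (s := range k) (f := fun i => |a i - b i|)
    _ ≤ _ := by
        simp only [sq_abs]
        exact mul_le_mul_of_nonneg_left (hk.trans (hM.sum_sub_sq_le hN)) (Nat.cast_nonneg k)

open Finset Matrix

/-- perturbation bound for squared singular values. Let `a, w : ℕ → ℝ` be
the squared singular values of `A ∈ ℂ^{m×n}` and `W ∈ ℂ^{q×p}` listed in nonincreasing
order and extended by `0` beyond the matrix dimension (so `a i` for `i < n` are the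
eigenvalues of `A†A` in nonincreasing order, and similarly `w` for `W†W`). If
`‖A†A − S†S‖_F ≤ θ` and `‖SS† − WW†‖_F ≤ θ` for some `S ∈ ℂ^{q×n}`, then for every
`k ≥ 1`, `∑_{i=1}^k |σ_i(A)² − σ_i(W)²| ≤ 2 √k θ`. -/
theorem stmt11 (m n q p : ℕ)
    (A : Matrix (Fin m) (Fin n) ℂ) (S : Matrix (Fin q) (Fin n) ℂ)
    (W : Matrix (Fin q) (Fin p) ℂ) (θ : ℝ) (hθ : 0 ≤ θ)
    (h1 : Real.sqrt (∑ i, ∑ j, ‖(Aᴴ * A - Sᴴ * S) i j‖ ^ 2) ≤ θ)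
    (h2 : Real.sqrt (∑ i, ∑ j, ‖(S * Sᴴ - W * Wᴴ) i j‖ ^ 2) ≤ θ)
    (a w : ℕ → ℝ) (haA : Antitone a) (hwA : Antitone w)
    (ha0 : ∀ i, n ≤ i → a i = 0) (hw0 : ∀ i, p ≤ i → w i = 0)
    (hUa : ∃ U ∈ Matrix.unitaryGroup (Fin n) ℂ,
      Aᴴ * A = U * Matrix.diagonal (fun i : Fin n => ((a i.val : ℝ) : ℂ)) * Uᴴ)
    (hUw : ∃ U ∈ Matrix.unitaryGroup (Fin p) ℂ,
      Wᴴ * W = U * Matrix.diagonal (fun i : Fin p => ((w i.val : ℝ) : ℂ)) * Uᴴ)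
    (k : ℕ) (hk : 1 ≤ k) :
    (∑ i ∈ Finset.range k, |a i - w i|) ≤ 2 * Real.sqrt k * θ := by
  obtain ⟨s, hs⟩ := exists_isSpectralSeq_conjTranspose_mul_self S
  have hA : IsSpectralSeq (Aᴴ * A) a := ⟨haA, ha0, hUa⟩
  have hW : IsSpectralSeq (Wᴴ * W) w := ⟨hwA, hw0, hUw⟩
  calc ∑ i ∈ range k, |a i - w i| ≤ ∑ i ∈ range k, (|a i - s i| + |s i - w i|) :=
        sum_le_sum fun i _ => abs_sub_le _ _ _
    _ = ∑ i ∈ range k, |a i - s i| + ∑ i ∈ range k, |s i - w i| := sum_add_distrib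
    _ ≤ √k * θ + √k * θ := add_le_add
        ((hA.sum_abs_sub_le hs k).trans (by gcongr))
        ((hs.mul_conjTranspose_self.sum_abs_sub_le hW.mul_conjTranspose_self k).trans (by gcongr))
    _ = 2 * √k * θ := by ring
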